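/- arXiv:2312.11147 — 4 statements merged into one kernel-verified Lean document; each statement's English description precedes it below -/
import Mathlib

section
/- The function d : C × C → ℝ, d(f,g) = (1 − m(f,g))/(1 + m(f,g)), satisfies: (a) 0 ≤ d(f,g) ≤ 1 for all f, g ∈ C; (b) d(f,g) = d(g,f); (c) d(f,g) = 0 if and only if there exists b > 0 with f = b·g; (d) d(f,h) ≤ d(f,g) + d(g,h) for all f, g, h ∈ C; (e) d(α·f, β·g) = d(f,g) for all α, β > 0. Hence d induces a distance, bounded by 1, on the set of equivalence classes of C under positive scaling. -/
/-- `aleph f g = sup {b ≥ 0 : b·f ≤ g pointwise}`. -/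
noncomputable def aleph {X : Type*} (f g : X → ℝ) : ℝ :=
  sSup {b : ℝ | 0 ≤ b ∧ ∀ x, b * f x ≤ g x}

/-- `m(f,g) = ℵ(f,g)·ℵ(g,f)`. -/
noncomputable def mRatio {X : Type*} (f g : X → ℝ) : ℝ := aleph f g * aleph g f

/-- The pseudo-Hilbert distance `d(f,g) = (1 − m(f,g))/(1 + m(f,g))`. -/
noncomputable def dProj {X : Type*} (f g : X → ℝ) : ℝ :=
  (1 - mRatio f g) / (1 + mRatio f g)

/-- Membership in the positive cone `C = {f ∈ E : f ≠ 0 and f(x) ≥ 0 for all x}`. -/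
def InCone {X : Type*} (E : Submodule ℝ (X → ℝ)) (f : X → ℝ) : Prop :=
  f ∈ E ∧ f ≠ 0 ∧ ∀ x, 0 ≤ f x
theorem isGreatest_aleph {X : Type*} {f g : X → ℝ} (hf0 : f ≠ 0) (hf : ∀ x, 0 ≤ f x)
    (hg : ∀ x, 0 ≤ g x) :
    IsGreatest {b : ℝ | 0 ≤ b ∧ ∀ x, b * f x ≤ g x} (aleph f g) := by
  obtain ⟨y, hy⟩ := Function.ne_iff.mp hf0
  have hy : 0 < f y := lt_of_le_of_ne (hf y) (Ne.symm hy)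
  have hne : {b : ℝ | 0 ≤ b ∧ ∀ x, b * f x ≤ g x}.Nonempty :=
    ⟨0, le_rfl, fun x => by simpa using hg x⟩
  have hbdd : BddAbove {b : ℝ | 0 ≤ b ∧ ∀ x, b * f x ≤ g x} :=
    ⟨g y / f y, fun b hb => (le_div_iff₀ hy).mpr (hb.2 y)⟩
  refine ⟨⟨le_csSup hbdd hne.some_mem |>.trans' hne.some_mem.1, fun x => ?_⟩,
    fun b hb => le_csSup hbdd hb⟩
  rcases (hf x).eq_or_lt with hx | hx
  · simpa [← hx] using hg x
  · exact (le_div_iff₀ hx).mp (csSup_le hne fun b hb => (le_div_iff₀ hx).mpr (hb.2 x))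

namespace InCone

variable {X : Type*} {E : Submodule ℝ (X → ℝ)} {f g h : X → ℝ}

theorem smul (hf : InCone E f) {a : ℝ} (ha : 0 < a) : InCone E (a • f) :=
  ⟨E.smul_mem a hf.1, smul_ne_zero ha.ne' hf.2.1, fun x => mul_nonneg ha.le (hf.2.2 x)⟩

theorem aleph_nonneg (hf : InCone E f) (hg : InCone E g) : 0 ≤ aleph f g :=
  (isGreatest_aleph hf.2.1 hf.2.2 hg.2.2).1.1

theorem aleph_mul_le (hf : InCone E f) (hg : InCone E g) (x : X) : aleph f g * f x ≤ g x :=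
  (isGreatest_aleph hf.2.1 hf.2.2 hg.2.2).1.2 x

theorem le_aleph (hf : InCone E f) (hg : InCone E g) {b : ℝ} (hb : 0 ≤ b)
    (hle : ∀ x, b * f x ≤ g x) : b ≤ aleph f g :=
  (isGreatest_aleph hf.2.1 hf.2.2 hg.2.2).2 ⟨hb, hle⟩

theorem aleph_mul_aleph_le (hf : InCone E f) (hg : InCone E g) (hh : InCone E h) :
    aleph f g * aleph g h ≤ aleph f h := by
  refine hf.le_aleph hh (mul_nonneg (hf.aleph_nonneg hg) (hg.aleph_nonneg hh)) fun x => ?_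
  calc aleph f g * aleph g h * f x = aleph g h * (aleph f g * f x) := by ring
    _ ≤ aleph g h * g x :=
      mul_le_mul_of_nonneg_left (hf.aleph_mul_le hg x) (hg.aleph_nonneg hh)
    _ ≤ h x := hg.aleph_mul_le hh x

theorem aleph_self_le_one (hf : InCone E f) : aleph f f ≤ 1 := by
  obtain ⟨y, hy⟩ := Function.ne_iff.mp hf.2.1
  have hy : 0 < f y := lt_of_le_of_ne (hf.2.2 y) (Ne.symm hy)
  exact le_of_mul_le_mul_right (by simpa using hf.aleph_mul_le hf y) hy

theorem mRatio_nonneg (hf : InCone E f) (hg : InCone E g) : 0 ≤ mRatio f g :=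
  mul_nonneg (hf.aleph_nonneg hg) (hg.aleph_nonneg hf)

theorem mRatio_le_one (hf : InCone E f) (hg : InCone E g) : mRatio f g ≤ 1 :=
  (hf.aleph_mul_aleph_le hg hf).trans hf.aleph_self_le_one

theorem mRatio_mul_mRatio_le (hf : InCone E f) (hg : InCone E g) (hh : InCone E h) :
    mRatio f g * mRatio g h ≤ mRatio f h :=
  calc mRatio f g * mRatio g h
      = (aleph f g * aleph g h) * (aleph h g * aleph g f) := by unfold mRatio; ring
    _ ≤ aleph f h * aleph h f :=
      mul_le_mul (hf.aleph_mul_aleph_le hg hh) (hh.aleph_mul_aleph_le hg hf)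
        (mul_nonneg (hh.aleph_nonneg hg) (hg.aleph_nonneg hf)) (hf.aleph_nonneg hh)

theorem mRatio_eq_one_iff (hf : InCone E f) (hg : InCone E g) :
    mRatio f g = 1 ↔ ∃ b : ℝ, 0 < b ∧ f = b • g := by
  constructor
  · intro hm
    have hb : 0 < aleph g f := by
      refine (hg.aleph_nonneg hf).lt_of_ne fun h0 => ?_
      simp [mRatio, ← h0] at hm
    refine ⟨aleph g f, hb, funext fun x => le_antisymm ?_ (hg.aleph_mul_le hf x)⟩
    calc f x = aleph g f * (aleph f g * f x) := by
          rw [← mul_assoc, mul_comm (aleph g f), show aleph f g * aleph g f = 1 from hm, one_mul]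
      _ ≤ aleph g f * g x := mul_le_mul_of_nonneg_left (hf.aleph_mul_le hg x) hb.le
  · rintro ⟨b, hb, hfg⟩
    refine (hf.mRatio_le_one hg).antisymm ?_
    have h₁ : b ≤ aleph g f := hg.le_aleph hf hb.le fun x => by simp [hfg]
    have h₂ : b⁻¹ ≤ aleph f g := hf.le_aleph hg (inv_nonneg.mpr hb.le) fun x => by
      simp [hfg, hb.ne']
    calc (1 : ℝ) = b⁻¹ * b := (inv_mul_cancel₀ hb.ne').symm
      _ ≤ aleph f g * aleph g f := mul_le_mul h₂ h₁ hb.le (hf.aleph_nonneg hg)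

theorem dProj_eq_zero_iff (hf : InCone E f) (hg : InCone E g) :
    dProj f g = 0 ↔ ∃ b : ℝ, 0 < b ∧ f = b • g := by
  have hm := hf.mRatio_nonneg hg
  rw [← hf.mRatio_eq_one_iff hg, dProj, div_eq_zero_iff, or_iff_left (by positivity),
    sub_eq_zero, eq_comm]

theorem dProj_triangle (hf : InCone E f) (hg : InCone E g) (hh : InCone E h) :
    dProj f h ≤ dProj f g + dProj g h := by
  have hle := hf.mRatio_mul_mRatio_le hg hh
  have hu := hf.mRatio_nonneg hg
  have hv := hg.mRatio_nonneg hh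
  have hw := hf.mRatio_nonneg hh
  have hu₁ := hf.mRatio_le_one hg
  have hv₁ := hg.mRatio_le_one hh
  unfold dProj
  generalize mRatio f g = u at *
  generalize mRatio g h = v at *
  generalize mRatio f h = w at *
  have huv : 0 ≤ u * v := mul_nonneg hu hv
  have huv₁ : u * v ≤ 1 := mul_le_one₀ hu₁ hv hv₁
  calc (1 - w) / (1 + w) ≤ (1 - u * v) / (1 + u * v) := by
        rw [div_le_div_iff₀ (by positivity) (by positivity)]
        nlinarith
    _ = 2 * (1 - u * v) / (2 * (1 + u * v)) := by rw [mul_div_mul_left _ _ two_ne_zero]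
    _ ≤ 2 * (1 - u * v) / ((1 + u) * (1 + v)) :=
        div_le_div_of_nonneg_left (by linarith) (by positivity)
          (by nlinarith [mul_nonneg (sub_nonneg.mpr hu₁) (sub_nonneg.mpr hv₁)])
    _ = (1 - u) / (1 + u) + (1 - v) / (1 + v) := by
        field_simp
        ring

theorem dProj_smul_smul_le (hf : InCone E f) (hg : InCone E g) {a b : ℝ} (ha : 0 < a)
    (hb : 0 < b) : dProj (a • f) (b • g) ≤ dProj f g := by
  have h₁ : dProj (a • f) f = 0 := ((hf.smul ha).dProj_eq_zero_iff hf).mpr ⟨a, ha, rfl⟩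
  have h₂ : dProj g (b • g) = 0 := (hg.dProj_eq_zero_iff (hg.smul hb)).mpr
    ⟨b⁻¹, inv_pos.mpr hb, (inv_smul_smul₀ hb.ne' g).symm⟩
  linarith [(hf.smul ha).dProj_triangle hf (hg.smul hb), hf.dProj_triangle hg (hg.smul hb)]

end InCone

theorem stmt_5 {X : Type*} (E : Submodule ℝ (X → ℝ)) :
    (∀ f g : X → ℝ, InCone E f → InCone E g → 0 ≤ dProj f g ∧ dProj f g ≤ 1) ∧
    (∀ f g : X → ℝ, InCone E f → InCone E g → dProj f g = dProj g f) ∧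
    (∀ f g : X → ℝ, InCone E f → InCone E g →
      (dProj f g = 0 ↔ ∃ b : ℝ, 0 < b ∧ f = b • g)) ∧
    (∀ f g h : X → ℝ, InCone E f → InCone E g → InCone E h →
      dProj f h ≤ dProj f g + dProj g h) ∧
    (∀ f g : X → ℝ, ∀ α β : ℝ, 0 < α → 0 < β → InCone E f → InCone E g →
      dProj (α • f) (β • g) = dProj f g) := by
  refine ⟨fun f g hf hg => ?_, fun f g _ _ => ?_, fun f g hf hg => hf.dProj_eq_zero_iff hg,
    fun f g h hf hg hh => hf.dProj_triangle hg hh, fun f g α β hα hβ hf hg => ?_⟩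
  · have h₀ := hf.mRatio_nonneg hg
    have h₁ := hf.mRatio_le_one hg
    exact ⟨div_nonneg (by linarith) (by linarith),
      (div_le_one (by linarith)).mpr (by linarith)⟩
  · simp only [dProj, mRatio, mul_comm]
  · refine (hf.dProj_smul_smul_le hg hα hβ).antisymm ?_
    simpa only [inv_smul_smul₀ hα.ne', inv_smul_smul₀ hβ.ne'] using
      (hf.smul hα).dProj_smul_smul_le (hg.smul hβ) (inv_pos.mpr hα) (inv_pos.mpr hβ)
end

section
/- Let f, g ∈ C and suppose there exist x, x' ∈ X with f(x) < g(x) and f(x') > g(x'). Then the set S = {t ∈ ℝ : t·f + (1−t)·g ∈ C} is a bounded interval containing 0 and 1; consequently the intersection of the line through f and g with C is a nondegenerate line segment [u,v] with u ≠ v. -/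
/-- On the line through two members `f`, `g` of the cone that are incomparable at `x` and `x'`,
being in the cone amounts to being pointwise nonnegative: the line avoids `0`. -/
theorem inCone_line_iff {X : Type*} {E : Submodule ℝ (X → ℝ)} {f g : X → ℝ}
    (hf : InCone E f) (hg : InCone E g) {x x' : X} (hx : f x < g x) (hx' : f x' > g x') (t : ℝ) :
    InCone E (t • f + (1 - t) • g) ↔ ∀ y, 0 ≤ t * f y + (1 - t) * g y := by
  refine ⟨fun h y => by simpa using h.2.2 y, fun h => ⟨?_, fun h0 => ?_, fun y => by simpa using h y⟩⟩
  · exact E.add_mem (E.smul_mem _ hf.1) (E.smul_mem _ hg.1)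
  · have h1 : t * f x + (1 - t) * g x = 0 := by simpa using congrFun h0 x
    have h2 : t * f x' + (1 - t) * g x' = 0 := by simpa using congrFun h0 x'
    have := hf.2.2 x
    have := hg.2.2 x'
    rcases le_or_gt t 0 with ht | ht <;> nlinarith

/-- A nonempty, closed, bounded, order-connected set of reals is a closed interval. -/
theorem eq_Icc_of_ordConnected_isClosed {S : Set ℝ} (hne : S.Nonempty) (hc : IsClosed S)
    (hb : BddBelow S) (ha : BddAbove S) (ho : S.OrdConnected) : S = Set.Icc (sInf S) (sSup S) :=
  eq_Icc_of_connected_compact ⟨hne, ho.isPreconnected⟩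
    (Metric.isCompact_of_isClosed_isBounded hc (isBounded_iff_bddBelow_bddAbove.2 ⟨hb, ha⟩))

theorem stmt_7 {X : Type*} (E : Submodule ℝ (X → ℝ)) (f g : X → ℝ)
    (hf : InCone E f) (hg : InCone E g) (x x' : X)
    (hx : f x < g x) (hx' : f x' > g x') :
    ((0 : ℝ) ∈ {t : ℝ | InCone E (t • f + (1 - t) • g)} ∧
      (1 : ℝ) ∈ {t : ℝ | InCone E (t • f + (1 - t) • g)} ∧
      BddBelow {t : ℝ | InCone E (t • f + (1 - t) • g)} ∧
      BddAbove {t : ℝ | InCone E (t • f + (1 - t) • g)} ∧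
      Set.OrdConnected {t : ℝ | InCone E (t • f + (1 - t) • g)}) ∧
    ∃ u v : X → ℝ, u ≠ v ∧
      {h : X → ℝ | (∃ t : ℝ, h = t • f + (1 - t) • g) ∧ InCone E h} = segment ℝ u v := by
  have key := inCone_line_iff hf hg hx hx'
  set S := {t : ℝ | InCone E (t • f + (1 - t) • g)} with hS
  have h0 : (0 : ℝ) ∈ S := by simpa [hS] using hg
  have h1 : (1 : ℝ) ∈ S := by simpa [hS] using hf
  have hb : BddBelow S := by
    refine ⟨-(g x' / (f x' - g x')), fun t ht => ?_⟩
    have := (key t).1 ht x'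
    rw [← neg_div, div_le_iff₀ (by linarith)]
    linarith
  have ha : BddAbove S := by
    refine ⟨g x / (g x - f x), fun t ht => ?_⟩
    have := (key t).1 ht x
    rw [le_div_iff₀ (by linarith)]
    linarith
  have ho : S.OrdConnected := by
    refine ⟨fun a hma b hmb t ht => (key t).2 fun y => ?_⟩
    have hya := (key a).1 hma y
    have hyb := (key b).1 hmb y
    rcases le_total (f y) (g y) with h | h
    · nlinarith [ht.1, ht.2]
    · nlinarith [ht.1, ht.2]
  have hc : IsClosed S := by
    have : S = ⋂ y, {t : ℝ | 0 ≤ t * f y + (1 - t) * g y} := by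
      ext t
      simpa [hS] using key t
    rw [this]
    exact isClosed_iInter fun y => isClosed_le (by fun_prop) (by fun_prop)
  have hI := eq_Icc_of_ordConnected_isClosed ⟨0, h0⟩ hc hb ha ho
  have hlt : sInf S < sSup S :=
    (csInf_le hb h0).trans_lt (zero_lt_one.trans_le (le_csSup ha h1))
  have hfg : g ≠ f := fun h => hx.ne (congrFun h x).symm
  refine ⟨⟨h0, h1, hb, ha, ho⟩, AffineMap.lineMap g f (sInf S), AffineMap.lineMap g f (sSup S),
    fun h => hlt.ne (AffineMap.lineMap_injective ℝ hfg h), ?_⟩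
  rw [← image_segment, segment_eq_Icc hlt.le, ← hI]
  have hline (t : ℝ) : AffineMap.lineMap g f t = t • f + (1 - t) • g := by
    rw [AffineMap.lineMap_apply_module, add_comm]
  ext h
  constructor
  · rintro ⟨⟨t, rfl⟩, ht⟩
    exact ⟨t, ht, hline t⟩
  · rintro ⟨t, ht, rfl⟩
    rw [hline]
    exact ⟨⟨t, rfl⟩, ht⟩
end

section
/- Let u, v ∈ C with u ≠ v, and suppose that for all t ∈ ℝ, t·u + (1−t)·v ∈ C if and only if 0 ≤ t ≤ 1. Let f = f₁·u + f₂·v ∈ C and g = g₁·u + g₂·v ∈ C. Then d(f,g) = |f₁g₂ − f₂g₁| / (f₁g₂ + f₂g₁), with the convention that this quotient is 0 when f₁g₂ + f₂g₁ = 0. -/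
/-- If `v - c • u ≥ 0` for some `c > 0`, then the line through `u` and `v` stays in the cone for
some negative parameter. Hence combinations in the cone have nonnegative `u`-coefficient. -/
theorem coeff_nonneg_of_segment {X : Type*} {E : Submodule ℝ (X → ℝ)} {u v : X → ℝ}
    (hu : InCone E u) (hv : InCone E v)
    (hseg : ∀ t : ℝ, InCone E (t • u + (1 - t) • v) → 0 ≤ t)
    {a b : ℝ} (hab : ∀ x, 0 ≤ a * u x + b * v x) : 0 ≤ a := by
  by_contra! ha
  obtain ⟨x₀, hx₀⟩ := Function.ne_iff.mp hu.2.1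
  have hux₀ : 0 < u x₀ := lt_of_le_of_ne (hu.2.2 x₀) (Ne.symm hx₀)
  have hb : 0 < b := by
    by_contra! hb
    nlinarith [hab x₀, mul_neg_of_neg_of_pos ha hux₀,
      mul_nonpos_of_nonpos_of_nonneg hb (hv.2.2 x₀)]
  set c := -a / b with hc
  have hcpos : 0 < c := div_pos (neg_pos.mpr ha) hb
  have hle : ∀ x, c * u x ≤ v x := fun x => by
    rw [hc, div_mul_eq_mul_div, div_le_iff₀ hb]
    linarith [hab x]
  have hlow : ∀ x, c ^ 2 * u x ≤ (-c) * u x + (1 - -c) * v x := fun x => by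
    nlinarith [hle x]
  have hmem : InCone E ((-c) • u + (1 - -c) • v) := by
    refine ⟨E.add_mem (E.smul_mem _ hu.1) (E.smul_mem _ hv.1), fun h => ?_, fun x => ?_⟩
    · have h₀ : (-c) * u x₀ + (1 - -c) * v x₀ = 0 := congrFun h x₀
      have : 0 < c ^ 2 * u x₀ := by positivity
      linarith [hlow x₀]
    · exact (mul_nonneg (sq_nonneg c) (hu.2.2 x)).trans (hlow x)
  linarith [hseg _ hmem]

section Coordinates

variable {X : Type*} {u v : X → ℝ}

theorem aleph_eq_div (hu : ∀ x, 0 ≤ u x)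
    (hcoeff : ∀ a b : ℝ, (∀ x, 0 ≤ a * u x + b * v x) → 0 ≤ a ∧ 0 ≤ b)
    {f₁ f₂ g₁ g₂ : ℝ} (hf₂ : 0 < f₂) (hg₂ : 0 ≤ g₂) (h : f₁ * g₂ ≤ f₂ * g₁) :
    aleph (f₁ • u + f₂ • v) (g₁ • u + g₂ • v) = g₂ / f₂ := by
  refine IsGreatest.csSup_eq ⟨⟨div_nonneg hg₂ hf₂.le, fun x => ?_⟩, fun b hb => ?_⟩
  · have h₁ : g₂ / f₂ * f₁ ≤ g₁ := by
      rw [div_mul_eq_mul_div, div_le_iff₀ hf₂]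
      linarith
    have h₂ : g₂ / f₂ * f₂ = g₂ := div_mul_cancel₀ _ hf₂.ne'
    calc g₂ / f₂ * (f₁ * u x + f₂ * v x)
        = g₂ / f₂ * f₁ * u x + g₂ / f₂ * f₂ * v x := by ring
      _ ≤ g₁ * u x + g₂ * v x := by
        rw [h₂]
        gcongr
        exact hu x
  · have hpair := hcoeff (g₁ - b * f₁) (g₂ - b * f₂) fun x => by
      have : b * (f₁ * u x + f₂ * v x) ≤ g₁ * u x + g₂ * v x := hb.2 x
      linarith
    rw [le_div_iff₀ hf₂]
    linarith [hpair.2]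

theorem aleph_eq_div' (hv : ∀ x, 0 ≤ v x)
    (hcoeff : ∀ a b : ℝ, (∀ x, 0 ≤ a * u x + b * v x) → 0 ≤ a ∧ 0 ≤ b)
    {f₁ f₂ g₁ g₂ : ℝ} (hf₁ : 0 < f₁) (hg₁ : 0 ≤ g₁) (h : f₂ * g₁ ≤ f₁ * g₂) :
    aleph (f₁ • u + f₂ • v) (g₁ • u + g₂ • v) = g₁ / f₁ := by
  rw [add_comm (f₁ • u), add_comm (g₁ • u)]
  exact aleph_eq_div hv
    (fun a b hab => (hcoeff b a fun x => by linarith [hab x]).symm) hf₁ hg₁ h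

theorem dProj_eq_of_le (hu : ∀ x, 0 ≤ u x) (hv : ∀ x, 0 ≤ v x)
    (hcoeff : ∀ a b : ℝ, (∀ x, 0 ≤ a * u x + b * v x) → 0 ≤ a ∧ 0 ≤ b)
    {f₁ f₂ g₁ g₂ : ℝ} (hf₁ : 0 ≤ f₁) (hf₂ : 0 ≤ f₂) (hg₁ : 0 ≤ g₁) (hg₂ : 0 ≤ g₂)
    (hf : 0 < f₁ ∨ 0 < f₂) (hg : 0 < g₁ ∨ 0 < g₂) (h : f₁ * g₂ ≤ f₂ * g₁) :
    dProj (f₁ • u + f₂ • v) (g₁ • u + g₂ • v) =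
      |f₁ * g₂ - f₂ * g₁| / (f₁ * g₂ + f₂ * g₁) := by
  rw [abs_of_nonpos (sub_nonpos.mpr h), dProj, mRatio]
  have h' : g₂ * f₁ ≤ g₁ * f₂ := by linarith
  rcases hf₂.eq_or_lt with rfl | hf₂
  · have hf₁ : 0 < f₁ := by simpa using hf
    obtain rfl : g₂ = 0 := by nlinarith
    have hg₁ : 0 < g₁ := by simpa using hg
    rw [aleph_eq_div' hv hcoeff hf₁ hg₁.le (by simp),
      aleph_eq_div' hv hcoeff hg₁ hf₁.le (by simp)]
    field_simp
    simp
  · rcases hg₁.eq_or_lt with rfl | hg₁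
    · have hg₂ : 0 < g₂ := by simpa using hg
      obtain rfl : f₁ = 0 := by nlinarith
      rw [aleph_eq_div hu hcoeff hf₂ hg₂.le h, aleph_eq_div hu hcoeff hg₂ hf₂.le (by simp)]
      field_simp
      simp
    · rw [aleph_eq_div hu hcoeff hf₂ hg₂ h, aleph_eq_div' hv hcoeff hg₁ hf₁ h']
      have : 0 < f₁ * g₂ + f₂ * g₁ := by positivity
      have : 0 < 1 + g₂ / f₂ * (f₁ / g₁) := by positivity
      rw [div_eq_div_iff (by positivity) (by positivity)]
      field_simp
      ring

end Coordinates

theorem pos_or_pos_of_combination_ne_zero {X : Type*} {u v : X → ℝ} {a b : ℝ}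
    (ha : 0 ≤ a) (hb : 0 ≤ b) (h : a • u + b • v ≠ 0) : 0 < a ∨ 0 < b := by
  by_contra! hab
  obtain rfl := le_antisymm hab.1 ha
  obtain rfl := le_antisymm hab.2 hb
  simp at h


theorem stmt_9 {X : Type*} (E : Submodule ℝ (X → ℝ)) (u v : X → ℝ)
    (hu : InCone E u) (hv : InCone E v) (huv : u ≠ v)
    (hseg : ∀ t : ℝ, InCone E (t • u + (1 - t) • v) ↔ 0 ≤ t ∧ t ≤ 1)
    (f₁ f₂ g₁ g₂ : ℝ)
    (hf : InCone E (f₁ • u + f₂ • v)) (hg : InCone E (g₁ • u + g₂ • v)) :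
    dProj (f₁ • u + f₂ • v) (g₁ • u + g₂ • v) =
      |f₁ * g₂ - f₂ * g₁| / (f₁ * g₂ + f₂ * g₁) := by
  have hcoeff : ∀ a b : ℝ, (∀ x, 0 ≤ a * u x + b * v x) → 0 ≤ a ∧ 0 ≤ b := fun a b hab =>
    ⟨coeff_nonneg_of_segment hu hv (fun t ht => ((hseg t).mp ht).1) hab,
      coeff_nonneg_of_segment (b := a) hv hu (fun t ht => by
        have := (hseg (1 - t)).mp (by rwa [sub_sub_cancel, add_comm])
        linarith [this.2]) fun x => by linarith [hab x]⟩
  obtain ⟨hf₁, hf₂⟩ := hcoeff f₁ f₂ hf.2.2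
  obtain ⟨hg₁, hg₂⟩ := hcoeff g₁ g₂ hg.2.2
  have hfpos := pos_or_pos_of_combination_ne_zero hf₁ hf₂ hf.2.1
  have hgpos := pos_or_pos_of_combination_ne_zero hg₁ hg₂ hg.2.1
  rcases le_total (f₁ * g₂) (f₂ * g₁) with h | h
  · exact dProj_eq_of_le hu.2.2 hv.2.2 hcoeff hf₁ hf₂ hg₁ hg₂ hfpos hgpos h
  · rw [add_comm (f₁ • u), add_comm (g₁ • u), abs_sub_comm, add_comm (f₁ * g₂)]
    exact dProj_eq_of_le hv.2.2 hu.2.2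
      (fun a b hab => (hcoeff b a fun x => by linarith [hab x]).symm)
      hf₂ hf₁ hg₂ hg₁ hfpos.symm hgpos.symm h
end

section
/- Let M : E → E be a linear map with M(C) ⊆ C, and set c(M) = sup{d(Mf', Mg') : f', g' ∈ C}. Then for all f, g ∈ C, d(Mf, Mg) ≤ c(M)·d(f,g). -/
/-- The contraction coefficient `c(M) = sup {d(Mf, Mg) : f, g ∈ C}`. -/
noncomputable def contractCoef {X : Type*} (E : Submodule ℝ (X → ℝ))
    (M : (X → ℝ) →ₗ[ℝ] (X → ℝ)) : ℝ :=
  sSup {r : ℝ | ∃ f g : X → ℝ, InCone E f ∧ InCone E g ∧ r = dProj (M f) (M g)}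

/-- `M` is `A`-uniformly positive: there is `h ∈ C` such that for every `f ∈ C`
there is `b(f) ≥ 0` with `A⁻¹·b(f)·h ≤ Mf ≤ A·b(f)·h` pointwise. -/
def UnifPos {X : Type*} (E : Submodule ℝ (X → ℝ))
    (M : (X → ℝ) →ₗ[ℝ] (X → ℝ)) (A : ℝ) : Prop :=
  ∃ h : X → ℝ, InCone E h ∧ ∀ f : X → ℝ, InCone E f →
    ∃ b : ℝ, 0 ≤ b ∧ (∀ x, A⁻¹ * b * h x ≤ M f x) ∧ (∀ x, M f x ≤ A * b * h x)

section Aleph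

variable {X : Type*} {f g : X → ℝ}

lemma aleph_nonneg (f g : X → ℝ) : 0 ≤ aleph f g :=
  Real.sSup_nonneg fun _ hb => hb.1

lemma exists_pos_of_nonneg_of_ne_zero (hf : ∀ x, 0 ≤ f x) (hf0 : f ≠ 0) : ∃ x, 0 < f x := by
  obtain ⟨x, hx⟩ := Function.ne_iff.mp hf0
  exact ⟨x, lt_of_le_of_ne (hf x) (Ne.symm hx)⟩

lemma le_aleph (hf : ∀ x, 0 ≤ f x) (hf0 : f ≠ 0) {b : ℝ} (hb : 0 ≤ b)
    (h : ∀ x, b * f x ≤ g x) : b ≤ aleph f g := by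
  obtain ⟨x, hx⟩ := exists_pos_of_nonneg_of_ne_zero hf hf0
  refine le_csSup ⟨g x / f x, ?_⟩ ⟨hb, h⟩
  rintro c ⟨-, hc⟩
  exact (le_div_iff₀ hx).2 (hc x)

lemma aleph_mul_le (hf : ∀ x, 0 ≤ f x) (hg : ∀ x, 0 ≤ g x) (x : X) :
    aleph f g * f x ≤ g x := by
  rcases (hf x).eq_or_lt with hx | hx
  · simpa [← hx] using hg x
  · refine (le_div_iff₀ hx).1 (csSup_le ⟨0, le_rfl, by simpa using hg⟩ ?_)
    rintro c ⟨-, hc⟩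
    exact (le_div_iff₀ hx).2 (hc x)

lemma mRatio_nonneg (f g : X → ℝ) : 0 ≤ mRatio f g :=
  mul_nonneg (aleph_nonneg f g) (aleph_nonneg g f)

lemma mRatio_comm (f g : X → ℝ) : mRatio f g = mRatio g f :=
  mul_comm _ _

lemma dProj_comm (f g : X → ℝ) : dProj f g = dProj g f := by
  rw [dProj, dProj, mRatio_comm]

lemma mRatio_le_one (hf : ∀ x, 0 ≤ f x) (hf0 : f ≠ 0) (hg : ∀ x, 0 ≤ g x) :
    mRatio f g ≤ 1 := by
  obtain ⟨x, hx⟩ := exists_pos_of_nonneg_of_ne_zero hf hf0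
  have h₁ := mul_le_mul_of_nonneg_left (aleph_mul_le hf hg x) (aleph_nonneg g f)
  have h₂ := aleph_mul_le hg hf x
  rw [mRatio]
  refine le_of_mul_le_mul_right ?_ hx
  linarith

lemma dProj_nonneg (hf : ∀ x, 0 ≤ f x) (hf0 : f ≠ 0) (hg : ∀ x, 0 ≤ g x) :
    0 ≤ dProj f g :=
  div_nonneg (sub_nonneg.2 (mRatio_le_one hf hf0 hg)) (by linarith [mRatio_nonneg f g])

lemma dProj_le_of_le_mRatio {r : ℝ} (hr : 0 ≤ r) (h : r ≤ mRatio f g) :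
    dProj f g ≤ (1 - r) / (1 + r) := by
  rw [dProj, div_le_div_iff₀ (by linarith) (by linarith)]
  linarith

lemma dProj_le_one (f g : X → ℝ) : dProj f g ≤ 1 := by
  simpa using dProj_le_of_le_mRatio le_rfl (mRatio_nonneg f g)

/-- Proportional functions are at distance at most zero. -/
lemma dProj_smul_le_zero (hf : ∀ x, 0 ≤ f x) (hf0 : f ≠ 0) {t : ℝ} (ht : 0 < t) :
    dProj f (t • f) ≤ 0 := by
  have h₁ : t ≤ aleph f (t • f) := le_aleph hf hf0 ht.le fun x => by simp
  have h₂ : t⁻¹ ≤ aleph (t • f) f :=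
    le_aleph (fun x => mul_nonneg ht.le (hf x)) (smul_ne_zero ht.ne' hf0) (inv_nonneg.2 ht.le)
      fun x => by simp [ht.ne']
  have h : 1 ≤ mRatio f (t • f) := by
    have := mul_le_mul h₁ h₂ (inv_nonneg.2 ht.le) (aleph_nonneg _ _)
    rwa [mul_inv_cancel₀ ht.ne'] at this
  simpa using dProj_le_of_le_mRatio zero_le_one h

lemma div_mul_div_le_mRatio (hf : ∀ x, 0 ≤ f x) (hf0 : f ≠ 0) (hg : ∀ x, 0 ≤ g x) (hg0 : g ≠ 0)
    {s t u v : ℝ} (hs : 0 ≤ s) (ht : 0 < t) (hu : 0 ≤ u) (hv : 0 < v)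
    (hfg : ∀ x, s * f x ≤ t * g x) (hgf : ∀ x, u * g x ≤ v * f x) :
    s / t * (u / v) ≤ mRatio f g := by
  refine mul_le_mul (le_aleph hf hf0 (by positivity) fun x => ?_)
    (le_aleph hg hg0 (by positivity) fun x => ?_) (by positivity) (aleph_nonneg _ _)
  · rw [div_mul_eq_mul_div, div_le_iff₀ ht, mul_comm (g x)]
    exact hfg x
  · rw [div_mul_eq_mul_div, div_le_iff₀ hv, mul_comm (f x)]
    exact hgf x

/-- The distance between `F` and `G` is controlled by that between the differences
`G - a F` and `F - b G`. -/
lemma dProj_le_dProj_sub_mul {F G : X → ℝ} (hF : ∀ x, 0 ≤ F x) (hF0 : F ≠ 0)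
    (hG : ∀ x, 0 ≤ G x) (hG0 : G ≠ 0) {a b : ℝ} (ha : 0 ≤ a) (hb : 0 ≤ b) (hab : a * b ≤ 1)
    (hP : ∀ x, 0 ≤ (G - a • F) x) (hP0 : G - a • F ≠ 0) (hQ : ∀ x, 0 ≤ (F - b • G) x) :
    dProj F G ≤ dProj (G - a • F) (F - b • G) * ((1 - a * b) / (1 + a * b)) := by
  set P := G - a • F with hPdef
  set Q := F - b • G with hQdef
  have hl := aleph_mul_le hP hQ
  have hm := aleph_mul_le hQ hP
  have hk := mRatio_le_one hP hP0 hQ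
  have hl0 := aleph_nonneg P Q
  have hm0 := aleph_nonneg Q P
  rw [dProj.eq_def P Q]
  rw [mRatio] at hk ⊢
  generalize aleph P Q = l at *
  generalize aleph Q P = m at *
  simp only [hPdef, hQdef, Pi.sub_apply, Pi.smul_apply, smul_eq_mul] at hl hm
  have key : (m + a) / (1 + m * b) * ((l + b) / (1 + l * a)) ≤ mRatio F G :=
    div_mul_div_le_mRatio hF hF0 hG hG0 (by positivity) (by positivity) (by positivity)
      (by positivity) (fun x => by linarith [hm x]) (fun x => by linarith [hl x])
  refine (dProj_le_of_le_mRatio (by positivity) key).trans ?_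
  have hd : 0 < (1 + m * b) * (1 + l * a) := by positivity
  have e : (1 - (m + a) / (1 + m * b) * ((l + b) / (1 + l * a))) /
      (1 + (m + a) / (1 + m * b) * ((l + b) / (1 + l * a))) =
      ((1 - l * m) * (1 - a * b)) / ((1 + l * m) * (1 + a * b) + 2 * (m * b + l * a)) := by
    have h₁ : (1 + m * b) ≠ 0 := by positivity
    have h₂ : (1 + l * a) ≠ 0 := by positivity
    rw [div_mul_div_comm, one_sub_div hd.ne', one_add_div hd.ne', div_div_div_cancel_right₀ hd.ne']
    congr 1 <;> ring
  rw [e, div_mul_div_comm]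
  refine div_le_div_of_nonneg_left (mul_nonneg (by linarith) (by linarith)) (by positivity) ?_
  have : 0 ≤ m * b + l * a := by positivity
  linarith

end Aleph

section ContractCoef

variable {X : Type*} {E : Submodule ℝ (X → ℝ)} {M : (X → ℝ) →ₗ[ℝ] (X → ℝ)} {f g : X → ℝ}

lemma dProj_le_contractCoef (hf : InCone E f) (hg : InCone E g) :
    dProj (M f) (M g) ≤ contractCoef E M := by
  refine le_csSup ⟨1, ?_⟩ ⟨f, g, hf, hg, rfl⟩
  rintro r ⟨-, -, -, -, rfl⟩
  exact dProj_le_one _ _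

end ContractCoef

theorem stmt_10 {X : Type*} (E : Submodule ℝ (X → ℝ))
    (M : (X → ℝ) →ₗ[ℝ] (X → ℝ))
    (hE : ∀ f ∈ E, M f ∈ E)
    (hC : ∀ f : X → ℝ, InCone E f → InCone E (M f)) :
    ∀ f g : X → ℝ, InCone E f → InCone E g →
      dProj (M f) (M g) ≤ contractCoef E M * dProj f g := by
  intro f g hf hg
  obtain ⟨hfE, hf0, hf_nonneg⟩ := id hf
  obtain ⟨hgE, hg0, hg_nonneg⟩ := id hg
  obtain ⟨-, hF0, hF⟩ := hC f hf
  obtain ⟨-, hG0, hG⟩ := hC g hg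
  have hd := dProj_nonneg hf_nonneg hf0 hg_nonneg
  have hrhs : 0 ≤ contractCoef E M * dProj f g :=
    mul_nonneg ((dProj_nonneg hF hF0 hG).trans (dProj_le_contractCoef hf hg)) hd
  have ha := aleph_nonneg f g
  have hb := aleph_nonneg g f
  by_cases hp0 : g - aleph f g • f = 0
  · have hgf : g = aleph f g • f := sub_eq_zero.1 hp0
    have hpos : 0 < aleph f g := ha.lt_of_ne fun h => hg0 (by rw [hgf, ← h, zero_smul])
    refine le_trans ?_ hrhs
    have := dProj_smul_le_zero hF hF0 hpos
    rwa [← map_smul, ← hgf] at this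
  by_cases hq0 : f - aleph g f • g = 0
  · have hfg : f = aleph g f • g := sub_eq_zero.1 hq0
    have hpos : 0 < aleph g f := hb.lt_of_ne fun h => hf0 (by rw [hfg, ← h, zero_smul])
    refine le_trans ?_ hrhs
    have := dProj_smul_le_zero hG hG0 hpos
    rwa [← map_smul, ← hfg, dProj_comm] at this
  have hp : InCone E (g - aleph f g • f) :=
    ⟨E.sub_mem hgE (E.smul_mem _ hfE), hp0,
      fun x => sub_nonneg.2 (aleph_mul_le hf_nonneg hg_nonneg x)⟩
  have hq : InCone E (f - aleph g f • g) :=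
    ⟨E.sub_mem hfE (E.smul_mem _ hgE), hq0,
      fun x => sub_nonneg.2 (aleph_mul_le hg_nonneg hf_nonneg x)⟩
  have hc := dProj_le_contractCoef (M := M) hp hq
  obtain ⟨-, hP0, hP⟩ := hC _ hp
  obtain ⟨-, -, hQ⟩ := hC _ hq
  rw [map_sub, map_smul] at hP0 hP hQ
  rw [map_sub, map_smul, map_sub, map_smul] at hc
  exact (dProj_le_dProj_sub_mul hF hF0 hG hG0 ha hb
    (mRatio_le_one hf_nonneg hf0 hg_nonneg) hP hP0 hQ).trans (mul_le_mul_of_nonneg_right hc hd)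
end
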